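/- There exists an absolute constant C > 0 with the following property: for every prime p ≥ 5, if for every Dirichlet character ψ modulo p every zero s of L(s,ψ) with 0 < Re(s) < 1 satisfies Re(s) = 1/2, then there exists a square-full primitive root g modulo p with 1 ≤ g ≤ C · 2^{6·ω(p−1)} · ω(p−1) · (log p)^{18} · log log p. -/

import Mathlib

/-- A positive integer `n` is square-full if every prime `q` dividing `n` satisfies `q^2 ∣ n`. -/
def Squarefull (n : ℕ) : Prop := ∀ q : ℕ, q.Prime → q ∣ n → q ^ 2 ∣ n

section LogWeights

open Complex Filter Topology MeasureTheory Metric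
open scoped Nat ArithmeticFunction.vonMangoldt

theorem DirichletCharacter.sum_range_level_eq_zero {N : ℕ} [NeZero N] {χ : DirichletCharacter ℂ N}
    (hχ : χ ≠ 1) : ∑ k ∈ Finset.range N, χ (k : ZMod N) = 0 := by
  rw [← MulChar.sum_eq_zero_of_ne_one hχ]
  refine Finset.sum_bij' (fun k _ => (k : ZMod N)) (fun a _ => a.val) ?_ ?_ ?_ ?_ ?_
  · simp
  · intro a _; simpa using ZMod.val_lt a
  · intro k hk; simpa using ZMod.val_cast_of_lt (Finset.mem_range.mp hk)
  · simp
  · simp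

theorem DirichletCharacter.norm_sum_range_le {N : ℕ} [NeZero N] {χ : DirichletCharacter ℂ N}
    (hχ : χ ≠ 1) (n : ℕ) : ‖∑ k ∈ Finset.range n, χ (k : ZMod N)‖ ≤ N := by
  induction n using Nat.strong_induction_on with
  | _ n ih =>
    rcases lt_or_ge n N with h | h
    · refine (norm_sum_le_of_le _ (fun k _ => χ.norm_le_one _)).trans ?_
      simpa using h.le
    · obtain ⟨m, rfl⟩ := Nat.exists_eq_add_of_le h
      rw [Finset.sum_range_add, sum_range_level_eq_zero hχ, zero_add]
      simpa using ih m (by have := NeZero.pos N; omega)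

theorem DirichletCharacter.norm_sum_Icc_le {p : ℕ} [Fact p.Prime] {χ : DirichletCharacter ℂ p}
    (hχ : χ ≠ 1) (n : ℕ) : ‖∑ k ∈ Finset.Icc 1 n, χ (k : ZMod p)‖ ≤ p := by
  have h := norm_sum_range_le hχ (n + 1)
  rw [Finset.sum_range_succ', Nat.cast_zero, MulChar.map_zero, add_zero] at h
  rw [show Finset.Icc 1 n = Finset.Ico 1 (n + 1) by ext; simp, Finset.sum_Ico_eq_sum_range]
  simpa [add_comm] using h

/-- Partial summation extends the integral representation of `L(s, χ)` to `Re s > 0`. -/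
theorem DirichletCharacter.LFunction_eq_mul_integral {p : ℕ} [Fact p.Prime]
    {χ : DirichletCharacter ℂ p} (hχ : χ ≠ 1) {s : ℂ} (hs : 0 < s.re) :
    LFunction χ s = s * ∫ t in Set.Ioi (1 : ℝ),
      (∑ k ∈ Finset.Icc 1 ⌊t⌋₊, χ (k : ZMod p)) * (t : ℂ) ^ (-(s + 1)) := by
  set S : ℝ → ℂ := fun t => ∑ k ∈ Finset.Icc 1 ⌊t⌋₊, χ (k : ZMod p) with hS
  set f : ℝ → ℂ := Set.indicator (Set.Ioi 1) S with hf
  have hSm : Measurable S :=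
    (measurable_from_nat (f := fun n => ∑ k ∈ Finset.Icc 1 n, χ (k : ZMod p))).comp
      Nat.measurable_floor
  have hfm : Measurable f := hSm.indicator measurableSet_Ioi
  have hfb : ∀ t, ‖f t‖ ≤ p := fun t =>
    (Set.indicator_eq_zero_or_self (Set.Ioi 1) S t).elim (fun h => by rw [hf, h]; simp)
      (fun h => by rw [hf, h]; exact norm_sum_Icc_le hχ _)
  have hmellin : ∀ z : ℂ, ∫ t in Set.Ioi (1 : ℝ), S t * (t : ℂ) ^ (-(z + 1)) = mellin f (-z) := by
    intro z
    rw [mellin, ← integral_indicator measurableSet_Ioi, ← integral_indicator measurableSet_Ioi]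
    congr 1 with t
    by_cases h1 : 1 < t
    · simp [hf, Set.indicator, h1, zero_lt_one.trans h1, mul_comm]
      exact Or.inl (by ring_nf)
    · simp [hf, Set.indicator, h1]
  have hdiff : ∀ z : ℂ, 0 < z.re → DifferentiableAt ℂ (mellin f) (-z) := by
    intro z hz
    refine mellin_differentiableAt_of_isBigO_rpow (a := 0) (b := -z.re - 1) ?_ ?_ (by simpa) ?_
      (by simp)
    · refine LocallyIntegrable.locallyIntegrableOn ?_ _
      exact (locallyIntegrable_const (p : ℝ)).mono hfm.aestronglyMeasurable
        (Eventually.of_forall fun t => by simpa using hfb t)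
    · refine Asymptotics.IsBigO.of_bound p (Eventually.of_forall fun t => by simpa using hfb t)
    · refine Asymptotics.IsBigO.of_bound 0 ?_
      filter_upwards [mem_nhdsWithin_of_mem_nhds (Iio_mem_nhds (zero_lt_one' ℝ))] with t ht
      simp [hf, Set.indicator_of_notMem
        (show t ∉ Set.Ioi (1 : ℝ) from not_lt.mpr (Set.mem_Iio.mp ht).le)]
  let U : Set ℂ := {z | 0 < z.re}
  have hU : IsOpen U := isOpen_lt continuous_const continuous_re
  have key : Set.EqOn (LFunction χ) (fun z => z * mellin f (-z)) U := by
    refine AnalyticOnNhd.eqOn_of_preconnected_of_eventuallyEq (𝕜 := ℂ) (z₀ := (2 : ℂ))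
      ?_ ?_ ?_ ?_ ?_
    · exact ((differentiable_LFunction hχ).differentiableOn).analyticOnNhd hU
    · refine DifferentiableOn.analyticOnNhd (fun z hz => ?_) hU
      refine DifferentiableAt.differentiableWithinAt ?_
      exact DifferentiableAt.fun_mul differentiableAt_id
        (DifferentiableAt.comp (g := mellin f) (f := fun w : ℂ => -w) z (hdiff z hz) (by fun_prop))
    · exact (convex_halfSpace_re_gt 0).isPreconnected
    · simp [U]
    · filter_upwards [(isOpen_lt continuous_const continuous_re).mem_nhds
        (show (1 : ℝ) < (2 : ℂ).re by simp)] with z hz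
      rw [LFunction_eq_LSeries χ hz, ← hmellin]
      refine LSeries_eq_mul_integral _ le_rfl (zero_lt_one.trans hz)
        (χ.LSeriesSummable_of_one_lt_re hz) ?_
      exact Asymptotics.IsBigO.of_bound p (Eventually.of_forall fun n => by
        simpa using norm_sum_Icc_le hχ n)
  rw [hmellin]
  exact key hs

theorem DirichletCharacter.norm_LFunction_le {p : ℕ} [Fact p.Prime]
    {χ : DirichletCharacter ℂ p} (hχ : χ ≠ 1) {s : ℂ} (hs : 0 < s.re) :
    ‖LFunction χ s‖ ≤ ‖s‖ * (p / s.re) := by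
  rw [LFunction_eq_mul_integral hχ hs, norm_mul]
  gcongr
  have hlt : -(s.re + 1) < -1 := by linarith
  have hint := integrableOn_Ioi_rpow_of_lt hlt zero_lt_one
  calc _ ≤ ∫ t in Set.Ioi (1 : ℝ), p * t ^ (-(s.re + 1)) := by
        refine norm_integral_le_of_norm_le (hint.const_mul _) ?_
        filter_upwards [ae_restrict_mem measurableSet_Ioi] with t ht
        rw [norm_mul, Complex.norm_cpow_eq_rpow_re_of_pos (zero_lt_one.trans ht)]
        simp only [neg_re, add_re, one_re]
        have := norm_sum_Icc_le hχ ⌊t⌋₊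
        have : 0 ≤ t ^ (-(s.re + 1)) := Real.rpow_nonneg (zero_lt_one.trans ht).le _
        gcongr
    _ = p / s.re := by
        rw [integral_const_mul, integral_Ioi_rpow_of_lt hlt zero_lt_one]
        simp; field_simp

/-- A bound for the logarithmic derivative of a zero-free holomorphic function on a disc. -/
theorem Complex.norm_deriv_div_le_of_ne_zero {f : ℂ → ℂ} {c : ℂ} {R r B b : ℝ}
    (hr : 0 < r) (hrR : r < R) (hf : DifferentiableOn ℂ f (ball c R))
    (hf0 : ∀ z ∈ ball c R, f z ≠ 0) (hB : ∀ z ∈ ball c R, ‖f z‖ ≤ B)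
    (hb : 0 < b) (hbc : b ≤ ‖f c‖) (hbB : b < B) {z : ℂ} (hz : z ∈ closedBall c r) :
    ‖deriv f z / f z‖ ≤ 8 * R / (R - r) ^ 2 * Real.log (B / b) := by
  have hR : 0 < R := hr.trans hrR
  have hcR : c ∈ ball c R := mem_ball_self hR
  have hfd : ∀ w ∈ ball c R, DifferentiableAt ℂ f w := fun w hw =>
    hf.differentiableAt (isOpen_ball.mem_nhds hw)
  obtain ⟨g, hgc, hg⟩ := ((hf.deriv isOpen_ball).div hf hf0).isExactOn_ball.with_val_at c 0
  have hexp : ∀ w ∈ ball c R, f w = f c * exp (g w) := by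
    intro w hw
    have hderiv : Set.EqOn (deriv fun w => f w * exp (-g w)) 0 (ball c R) := fun u hu => by
      have h := ((hfd u hu).hasDerivAt.fun_mul (hg u hu).fun_neg.cexp).deriv
      have h0 := hf0 u hu
      rw [Pi.zero_apply, h, Pi.div_apply]
      field_simp
      ring
    have hconst := isOpen_ball.is_const_of_deriv_eq_zero
      (convex_ball c R).isPreconnected (fun u hu => ((hfd u hu).fun_mul
        (hg u hu).differentiableAt.fun_neg.cexp).differentiableWithinAt) hderiv hw hcR
    simp only [hgc, neg_zero, exp_zero, mul_one] at hconst
    rw [← hconst, mul_assoc, ← exp_add]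
    simp
  have hM : 0 < Real.log (B / b) := Real.log_pos ((one_lt_div hb).mpr hbB)
  set M := Real.log (B / b) with hMdef
  have hre : ∀ w ∈ ball c R, (g w).re ≤ M := by
    intro w hw
    have h1 : ‖f w‖ = ‖f c‖ * Real.exp (g w).re := by
      rw [hexp w hw, norm_mul, norm_exp]
    have h2 : b * Real.exp (g w).re ≤ B := by
      refine le_trans ?_ (hB w hw)
      rw [h1]; gcongr
    rw [hMdef, Real.le_log_iff_exp_le (div_pos (hb.trans hbB) hb), le_div_iff₀ hb, mul_comm]
    exact h2
  set r₁ := (r + R) / 2 with hr₁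
  have hgb : ∀ w, ‖w - c‖ ≤ r₁ → ‖g w‖ ≤ 2 * M * R / (R - r₁) := by
    intro w hw
    have hwR : w - c ∈ ball (0 : ℂ) R := by rw [mem_ball_zero_iff]; linarith
    have hmem : ∀ u ∈ ball (0 : ℂ) R, c + u ∈ ball c R := by
      intro u hu; simpa [dist_eq_norm] using hu
    have := borelCaratheodory_zero (f := fun u => g (c + u)) hM ?_ ?_ hR hwR (by simpa using hgc)
    · simp only [add_sub_cancel] at this
      refine this.trans ?_
      have h3 : 0 < R - r₁ := by rw [hr₁]; linarith
      have h4 : ‖w - c‖ ≤ R := by linarith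
      gcongr
    · intro u hu
      exact (((hg _ (hmem u hu)).differentiableAt).comp u
        (by fun_prop)).differentiableWithinAt
    · exact fun u hu => hre _ (hmem u hu)
  have hzc : ‖z - c‖ ≤ r := by simpa [dist_eq_norm] using hz
  have hzR : z ∈ ball c R := by rw [mem_ball, dist_eq_norm]; linarith
  have hd : 0 < r₁ - r := by rw [hr₁]; linarith
  have hsub : ∀ w ∈ closedBall z (r₁ - r), ‖w - c‖ ≤ r₁ := by
    intro w hw
    have h5 : ‖w - z‖ ≤ r₁ - r := by simpa [dist_eq_norm] using hw
    calc ‖w - c‖ = ‖(w - z) + (z - c)‖ := by ring_nf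
      _ ≤ ‖w - z‖ + ‖z - c‖ := norm_add_le _ _
      _ ≤ r₁ := by linarith
  have hgd : ∀ w ∈ closedBall z (r₁ - r), DifferentiableAt ℂ g w := by
    intro w hw
    refine (hg w ?_).differentiableAt
    rw [mem_ball, dist_eq_norm]
    have := hsub w hw
    linarith
  have hfin := norm_deriv_le_of_forall_mem_sphere_norm_le (c := z) (f := g) hd ?_
    (fun w hw => hgb w (hsub w (sphere_subset_closedBall hw)))
  · have h6 : deriv g z = deriv f z / f z := (hg z hzR).deriv
    rw [h6] at hfin
    refine hfin.trans (le_of_eq ?_)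
    have h7 : R - r ≠ 0 := by linarith
    rw [hr₁, show R - (r + R) / 2 = (R - r) / 2 by ring, show (r + R) / 2 - r = (R - r) / 2 by ring]
    field_simp
    norm_num
  · refine DifferentiableOn.diffContOnCl fun w hw => ?_
    exact (hgd w (closure_ball_subset_closedBall hw)).differentiableWithinAt

theorem Finset.one_div_card_add_one_le_prod_one_sub_inv (s : Finset ℕ) (hs : ∀ q ∈ s, 2 ≤ q) :
    (1 : ℝ) / (s.card + 1) ≤ ∏ q ∈ s, (1 - (q : ℝ)⁻¹) := by
  induction s using Finset.induction_on_max with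
  | empty => simp
  | insert a s ha ih =>
    have hs' : ∀ q ∈ s, 2 ≤ q := fun q hq => hs q (Finset.mem_insert_of_mem hq)
    have hns : a ∉ s := fun h => (ha a h).false
    have ha2 := hs a (Finset.mem_insert_self a s)
    have hcard : s.card ≤ (Finset.Ico 2 a).card :=
      Finset.card_le_card fun q hq => Finset.mem_Ico.mpr ⟨hs' q hq, ha q hq⟩
    rw [Nat.card_Ico] at hcard
    have hcard' : (s.card : ℝ) + 2 ≤ a := by exact_mod_cast (by omega : s.card + 2 ≤ a)
    rw [Finset.prod_insert hns, Finset.card_insert_of_notMem hns]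
    have h1 : (1 : ℝ) - (s.card + 2 : ℝ)⁻¹ ≤ 1 - (a : ℝ)⁻¹ := by gcongr
    have h2 : (0 : ℝ) ≤ 1 - (s.card + 2 : ℝ)⁻¹ := by
      have : (s.card + 2 : ℝ)⁻¹ ≤ 1 := inv_le_one_of_one_le₀
        (by linarith [(s.card).cast_nonneg (α := ℝ)])
      linarith
    refine le_trans (le_of_eq ?_) (mul_le_mul h1 (ih hs') (by positivity) (h2.trans h1))
    push_cast
    field_simp
    ring

namespace DirichletCharacter

variable {p : ℕ}

/-- The function `f` has an expansion into Dirichlet characters with coefficients of `ℓ¹` norm at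
most `M`. -/
def HasCharExpansion (f : ZMod p → ℂ) (M : ℝ) : Prop :=
  ∃ c : DirichletCharacter ℂ p → ℂ, ∑ χ, ‖c χ‖ ≤ M ∧ ∀ x, f x = ∑ χ, c χ * χ x

theorem HasCharExpansion.mul {f g : ZMod p → ℂ} {M M' : ℝ} (hM : 0 ≤ M)
    (hf : HasCharExpansion f M) (hg : HasCharExpansion g M') :
    HasCharExpansion (fun x => f x * g x) (M * M') := by
  obtain ⟨c, hc, hfc⟩ := hf
  obtain ⟨d, hd, hgd⟩ := hg
  refine ⟨fun χ => ∑ ψ, c ψ * d (ψ⁻¹ * χ), ?_, fun x => ?_⟩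
  · calc ∑ χ, ‖∑ ψ, c ψ * d (ψ⁻¹ * χ)‖ ≤ ∑ χ, ∑ ψ, ‖c ψ‖ * ‖d (ψ⁻¹ * χ)‖ :=
        Finset.sum_le_sum fun χ _ => (norm_sum_le _ _).trans_eq (by simp only [norm_mul])
      _ = ∑ ψ, ‖c ψ‖ * ∑ χ, ‖d χ‖ := by
        rw [Finset.sum_comm]
        refine Finset.sum_congr rfl fun ψ _ => ?_
        rw [← Finset.mul_sum]
        exact congrArg _ (Equiv.sum_comp (Equiv.mulLeft ψ⁻¹) fun χ => ‖d χ‖)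
      _ ≤ M * M' := by
        rw [← Finset.sum_mul]
        exact mul_le_mul hc hd (Finset.sum_nonneg fun _ _ => norm_nonneg _) hM
  · simp only [Finset.sum_mul]
    rw [Finset.sum_comm, hfc, hgd, Finset.sum_mul]
    refine Finset.sum_congr rfl fun ψ _ => ?_
    rw [Finset.mul_sum, ← Equiv.sum_comp (Equiv.mulLeft ψ⁻¹)]
    refine Finset.sum_congr rfl fun χ _ => ?_
    have h : χ x = ψ x * (ψ⁻¹ * χ) x := by
      rw [← MulChar.mul_apply, mul_inv_cancel_left]
    simp only [Equiv.coe_mulLeft]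
    rw [h]
    ring

variable [Fact p.Prime]

instance : IsCyclic (DirichletCharacter ℂ p) := by
  obtain ⟨e⟩ := MulChar.mulEquiv_units (ZMod p) ℂ
  exact e.isCyclic.mpr inferInstance

open Classical in
theorem card_filter_pow_eq_one_le {n : ℕ} (hn : 0 < n) :
    (Finset.univ.filter fun χ : DirichletCharacter ℂ p => χ ^ n = 1).card ≤ n :=
  IsCyclic.card_pow_eq_one_le hn

open Classical in
/-- The indicator function of the units that are not `q`-th powers, as a character sum. -/
noncomputable def nonresidue (q : ℕ) (x : ZMod p) : ℂ :=
  (1 : DirichletCharacter ℂ p) x -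
    ((Finset.univ.filter fun χ : DirichletCharacter ℂ p => χ ^ q = 1).card : ℂ)⁻¹ *
      ∑ χ : DirichletCharacter ℂ p with χ ^ q = 1, χ x

theorem hasCharExpansion_nonresidue {q : ℕ} (hq : 0 < q) :
    HasCharExpansion (nonresidue (p := p) q) (2 * (1 - (q : ℝ)⁻¹)) := by
  classical
  set H := Finset.univ.filter fun χ : DirichletCharacter ℂ p => χ ^ q = 1 with hH
  have h1 : (1 : DirichletCharacter ℂ p) ∈ H := by simp [hH]
  have hH0 : 0 < H.card := Finset.card_pos.mpr ⟨1, h1⟩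
  have hHq : H.card ≤ q := card_filter_pow_eq_one_le hq
  have hH1 : (H.card : ℝ)⁻¹ ≤ 1 := inv_le_one_of_one_le₀ (by exact_mod_cast hH0)
  refine ⟨fun χ => (if χ = 1 then 1 else 0) - if χ ∈ H then (H.card : ℂ)⁻¹ else 0, ?_, fun x => ?_⟩
  · have h2 : ∀ χ : DirichletCharacter ℂ p,
        ‖(if χ = 1 then (1 : ℂ) else 0) - if χ ∈ H then (H.card : ℂ)⁻¹ else 0‖ =
          (if χ = 1 then (1 - 2 * (H.card : ℝ)⁻¹) else 0) +
            if χ ∈ H then (H.card : ℝ)⁻¹ else 0 := by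
      intro χ
      by_cases hχ : χ = 1
      · subst hχ
        simp only [if_true, h1]
        rw [show (1 : ℂ) - (H.card : ℂ)⁻¹ = ((1 - (H.card : ℝ)⁻¹ : ℝ) : ℂ) by push_cast; rfl,
          Complex.norm_real, Real.norm_of_nonneg (by linarith)]
        ring
      · by_cases hχ2 : χ ∈ H <;> simp [hχ, hχ2]
    simp only [h2]
    rw [Finset.sum_add_distrib, Finset.sum_ite_eq' Finset.univ 1, if_pos (Finset.mem_univ _),
      Finset.sum_ite_mem, Finset.univ_inter, Finset.sum_const, nsmul_eq_mul,
      mul_inv_cancel₀ (by positivity)]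
    have : (q : ℝ)⁻¹ ≤ (H.card : ℝ)⁻¹ := by gcongr
    linarith
  · simp only [sub_mul, ite_mul, one_mul, zero_mul]
    rw [Finset.sum_sub_distrib, Finset.sum_ite_eq' Finset.univ 1, if_pos (Finset.mem_univ _),
      Finset.sum_ite_mem, Finset.univ_inter, nonresidue, Finset.mul_sum]

theorem nonresidue_pow {q : ℕ} (y : (ZMod p)ˣ) :
    nonresidue (p := p) q ((y : ZMod p) ^ q) = 0 := by
  classical
  have h : ∀ χ ∈ Finset.univ.filter (fun χ : DirichletCharacter ℂ p => χ ^ q = 1),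
      χ ((y : ZMod p) ^ q) = 1 := by
    intro χ hχ
    rw [map_pow, ← MulChar.pow_apply_coe, (Finset.mem_filter.mp hχ).2, MulChar.one_apply_coe]
  rw [nonresidue, Finset.sum_congr rfl h, ← Units.val_pow_eq_pow_val, MulChar.one_apply_coe,
    Finset.sum_const, nsmul_one, inv_mul_cancel₀, sub_self]
  exact_mod_cast (Finset.card_pos.mpr ⟨1, by simp⟩).ne'

theorem nonresidue_eq_one {q : ℕ} (hq : q ∣ p - 1) {x : (ZMod p)ˣ} (hx : x ^ ((p - 1) / q) ≠ 1) :
    nonresidue (p := p) q x = 1 := by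
  classical
  obtain ⟨χ, hχ⟩ := MulChar.exists_apply_ne_one_of_hasEnoughRootsOfUnity (ZMod p) ℂ
    (a := ((x ^ ((p - 1) / q) : (ZMod p)ˣ) : ZMod p)) (by rwa [Ne, Units.val_eq_one])
  rw [Units.val_pow_eq_pow_val, map_pow, ← MulChar.pow_apply_coe] at hχ
  set ψ := χ ^ ((p - 1) / q) with hψ
  have hψq : ψ ^ q = 1 := by
    rw [hψ, ← pow_mul, Nat.div_mul_cancel hq]
    ext u
    rw [MulChar.pow_apply_coe, ← map_pow, ← Units.val_pow_eq_pow_val,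
      ZMod.units_pow_card_sub_one_eq_one]
    simp
  have hsum : ψ x * ∑ χ : DirichletCharacter ℂ p with χ ^ q = 1, χ x =
      ∑ χ : DirichletCharacter ℂ p with χ ^ q = 1, χ x := by
    rw [Finset.mul_sum]
    refine Finset.sum_equiv (Equiv.mulLeft ψ) (fun χ => ?_) fun χ _ => ?_
    · simp [mul_pow, hψq]
    · simp
  have h0 : ∑ χ : DirichletCharacter ℂ p with χ ^ q = 1, χ (x : ZMod p) = 0 := by
    by_contra h
    exact hχ (mul_right_cancel₀ h (hsum.trans (one_mul _).symm))
  rw [nonresidue, h0]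
  simp

theorem one_mul_prod_nonresidue (hp : 3 ≤ p) (x : ZMod p) :
    (1 : DirichletCharacter ℂ p) x * ∏ q ∈ (p - 1).primeFactors, nonresidue q x =
      if orderOf x = p - 1 then 1 else 0 := by
  rcases eq_or_ne x 0 with rfl | hx
  · rw [MulChar.map_zero, zero_mul, if_neg]
    rw [orderOf_zero]
    omega
  obtain ⟨u, rfl⟩ := hx.isUnit
  rw [MulChar.one_apply_coe, one_mul, orderOf_units]
  by_cases h : ∀ q : ℕ, q.Prime → q ∣ p - 1 → u ^ ((p - 1) / q) ≠ 1
  · rw [if_pos (orderOf_eq_of_pow_and_pow_div_prime (by omega)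
      (ZMod.units_pow_card_sub_one_eq_one p u) h)]
    exact Finset.prod_eq_one fun q hq => nonresidue_eq_one (Nat.dvd_of_mem_primeFactors hq)
      (h q (Nat.prime_of_mem_primeFactors hq) (Nat.dvd_of_mem_primeFactors hq))
  · push Not at h
    obtain ⟨q, hq, hqd, hu⟩ := h
    have hdiv : 0 < (p - 1) / q := Nat.div_pos (Nat.le_of_dvd (by omega) hqd) hq.pos
    rw [if_neg fun ho => ?_]
    · refine Finset.prod_eq_zero (Nat.mem_primeFactors.mpr ⟨hq, hqd, by omega⟩) ?_
      obtain ⟨g, hg⟩ := IsCyclic.exists_generator (α := (ZMod p)ˣ)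
      have hgo : orderOf g = p - 1 := by
        rw [orderOf_eq_card_of_forall_mem_zpowers hg, Nat.card_eq_fintype_card, ZMod.card_units]
      obtain ⟨j, rfl⟩ := (mem_powers_iff_mem_zpowers.mpr (hg u))
      simp only at hu ⊢
      rw [← pow_mul, ← orderOf_dvd_iff_pow_eq_one, hgo] at hu
      have hqj : q ∣ j := by
        rw [← Nat.mul_dvd_mul_iff_right hdiv, Nat.mul_div_cancel' hqd]
        exact hu
      obtain ⟨i, rfl⟩ := hqj
      rw [mul_comm, pow_mul, Units.val_pow_eq_pow_val]
      exact nonresidue_pow _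
    · have := Nat.le_of_dvd hdiv (orderOf_dvd_of_pow_eq_one hu)
      rw [ho] at this
      exact absurd this (Nat.div_lt_self (by omega) hq.one_lt).not_ge

theorem hasCharExpansion_prod_nonresidue (s : Finset ℕ) (hs : ∀ q ∈ s, 0 < q) :
    HasCharExpansion (fun x => (1 : DirichletCharacter ℂ p) x * ∏ q ∈ s, nonresidue q x)
      (∏ q ∈ s, (2 * (1 - (q : ℝ)⁻¹))) := by
  classical
  induction s using Finset.induction_on with
  | empty =>
    refine ⟨fun χ => if χ = 1 then 1 else 0, ?_, fun x => ?_⟩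
    · simp [apply_ite norm]
    · simp
  | insert a s ha ih =>
    have h := (hasCharExpansion_nonresidue (p := p) (hs a (by simp))).mul (by
      have : ((a : ℝ))⁻¹ ≤ 1 := inv_le_one_of_one_le₀ (by exact_mod_cast hs a (by simp))
      linarith) (ih fun q hq => hs q (by simp [hq]))
    rw [Finset.prod_insert ha]
    convert h using 2 with x
    rw [Finset.prod_insert ha]
    ring

theorem card_filter_orderOf_eq (hp : 3 ≤ p) :
    (Finset.univ.filter fun x : ZMod p => orderOf x = p - 1).card = φ (p - 1) := by
  obtain ⟨g, hg⟩ := IsCyclic.exists_generator (α := (ZMod p)ˣ)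
  have hgo : orderOf (g : ZMod p) = p - 1 := by
    rw [orderOf_units, orderOf_eq_card_of_forall_mem_zpowers hg, Nat.card_eq_fintype_card,
      ZMod.card_units]
  rw [← (IsPrimitiveRoot.iff_orderOf.mpr hgo).card_primitiveRoots]
  congr 1
  ext x
  rw [mem_primitiveRoots (by omega), IsPrimitiveRoot.iff_orderOf]
  simp

/-- Vinogradov's expansion of the indicator function of the primitive roots. -/
theorem exists_charExpansion_primitiveRoot (hp : 3 ≤ p) :
    ∃ (c : DirichletCharacter ℂ p → ℂ) (d : ℝ), 1 / (((p - 1).primeFactors.card : ℝ) + 1) ≤ d ∧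
      c 1 = d ∧ (∀ χ, ‖c χ‖ ≤ d) ∧ ∑ χ, ‖c χ‖ ≤ 2 ^ (p - 1).primeFactors.card * d ∧
      ∀ x : ZMod p, ∑ χ, c χ * χ x = if orderOf x = p - 1 then 1 else 0 := by
  obtain ⟨c, hc, hcx⟩ := hasCharExpansion_prod_nonresidue (p := p) (p - 1).primeFactors
    fun q hq => (Nat.prime_of_mem_primeFactors hq).pos
  simp only [one_mul_prod_nonresidue hp] at hcx
  have hN : (0 : ℝ) < (p - 1 : ℕ) := by exact_mod_cast (by omega : 0 < p - 1)
  have hcoef : ∀ χ : DirichletCharacter ℂ p,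
      c χ * (p - 1 : ℕ) = ∑ x : ZMod p with orderOf x = p - 1, χ⁻¹ x := by
    intro χ
    have h1 : ∀ x : ZMod p, (if orderOf x = p - 1 then χ⁻¹ x else 0) =
        ∑ ψ, c ψ * (ψ * χ⁻¹) x := by
      intro x
      have := congrArg (· * χ⁻¹ x) (hcx x)
      simp only [ite_mul, one_mul, zero_mul, Finset.sum_mul] at this
      rw [this]
      refine Finset.sum_congr rfl fun ψ _ => ?_
      rw [MulChar.mul_apply]
      ring
    rw [Finset.sum_filter, Finset.sum_congr rfl fun x _ => h1 x, Finset.sum_comm,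
      Finset.sum_eq_single χ]
    · rw [← Finset.mul_sum, mul_inv_cancel, MulChar.sum_one_eq_card_units, ZMod.card_units]
    · intro ψ _ hψ
      rw [← Finset.mul_sum, MulChar.sum_eq_zero_of_ne_one, mul_zero]
      rwa [Ne, mul_inv_eq_one]
    · simp
  have hprod : (φ (p - 1) : ℝ) / (p - 1 : ℕ) =
      ∏ q ∈ (p - 1).primeFactors, (1 - (q : ℝ)⁻¹) := by
    have h := congrArg (Rat.cast : ℚ → ℝ) (Nat.totient_eq_mul_prod_factors (p - 1))
    rw [Rat.cast_mul, Rat.cast_prod, Rat.cast_natCast, Rat.cast_natCast] at h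
    rw [h]
    field_simp
    simp
  refine ⟨c, φ (p - 1) / (p - 1 : ℕ), ?_, ?_, fun χ => ?_, ?_, fun x => (hcx x).symm⟩
  · rw [hprod]
    exact Finset.one_div_card_add_one_le_prod_one_sub_inv _
      fun q hq => (Nat.prime_of_mem_primeFactors hq).two_le
  · have h := hcoef 1
    have h2 : ∀ x ∈ Finset.univ.filter (fun x : ZMod p => orderOf x = p - 1),
        (1⁻¹ : DirichletCharacter ℂ p) x = 1 := by
      intro x hx
      have hx0 : x ≠ 0 := by
        rintro rfl
        have := (Finset.mem_filter.mp hx).2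
        rw [orderOf_zero] at this
        omega
      rw [inv_one, MulChar.one_apply hx0.isUnit]
    rw [Finset.sum_congr rfl h2, Finset.sum_const, card_filter_orderOf_eq hp, nsmul_one] at h
    rw [Complex.ofReal_div, Complex.ofReal_natCast, Complex.ofReal_natCast,
      eq_div_iff (by exact_mod_cast hN.ne'), h]
  · rw [le_div_iff₀ hN, ← card_filter_orderOf_eq hp]
    have h := congrArg norm (hcoef χ)
    rw [norm_mul, Complex.norm_natCast] at h
    rw [h]
    refine (norm_sum_le _ _).trans ((Finset.sum_le_card_nsmul _ _ 1 fun x _ => ?_).trans_eq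
      (nsmul_one _))
    exact norm_le_one _ _
  · rw [hprod]
    refine hc.trans_eq ?_
    rw [Finset.prod_mul_distrib, Finset.prod_const]

end DirichletCharacter

theorem LSeries.logMul_iterate_apply (f : ℕ → ℂ) (k n : ℕ) :
    logMul^[k] f n = Complex.log n ^ k * f n := by
  induction k generalizing f with
  | zero => simp
  | succ k ih => rw [Function.iterate_succ_apply, ih, logMul]; ring

/-- The weight `Λ(n) (log n)^k / (k! n^c)`, which concentrates around `log n = k / (c - 1)`. -/
noncomputable def logWeight (c k n : ℕ) : ℝ := Λ n * Real.log n ^ k / (k ! * (n : ℝ) ^ c)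

theorem logWeight_nonneg (c k n : ℕ) : 0 ≤ logWeight c k n := by
  have := Real.log_natCast_nonneg n
  have := ArithmeticFunction.vonMangoldt_nonneg (n := n)
  unfold logWeight
  positivity

theorem LSeries.term_logMul_iterate_vonMangoldt (c k n : ℕ) (a : ℕ → ℂ) :
    LSeries.term (logMul^[k] (a * fun n => (Λ n : ℂ))) c n = k ! * (logWeight c k n * a n) := by
  rcases eq_or_ne n 0 with rfl | hn
  · simp [logWeight]
  · have h : (k ! : ℂ) ≠ 0 := mod_cast k.factorial_ne_zero
    rw [LSeries.term_of_ne_zero hn, logMul_iterate_apply, logWeight]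
    push_cast
    rw [Complex.cpow_natCast]
    field_simp
    rw [Pi.mul_apply]
    ring

theorem DirichletCharacter.abscissaOfAbsConv_twist_vonMangoldt_lt {N : ℕ}
    (χ : DirichletCharacter ℂ N) {c : ℕ} (hc : 2 ≤ c) :
    LSeries.abscissaOfAbsConv ((fun n : ℕ => χ (n : ZMod N)) * fun n : ℕ => (Λ n : ℂ)) <
      ((c : ℂ).re : ℝ) := by
  have h : LSeriesSummable ((fun n : ℕ => χ (n : ZMod N)) * fun n : ℕ => (Λ n : ℂ))
      ((3 / 2 : ℝ) : ℂ) :=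
    LSeriesSummable_twist_vonMangoldt χ (by norm_num)
  refine h.abscissaOfAbsConv_le.trans_lt ?_
  rw [EReal.coe_lt_coe_iff, Complex.ofReal_re, Complex.natCast_re]
  have : (2 : ℝ) ≤ c := mod_cast hc
  linarith

theorem summable_logWeight {c : ℕ} (hc : 2 ≤ c) (k : ℕ) : Summable (logWeight c k) := by
  have h1 := (1 : DirichletCharacter ℂ 1).abscissaOfAbsConv_twist_vonMangoldt_lt hc
  rw [← LSeries.absicssaOfAbsConv_logPowMul (m := k)] at h1
  have h2 := LSeriesSummable_of_abscissaOfAbsConv_lt_re h1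
  have h3 : Summable fun n => ((k ! * logWeight c k n : ℝ) : ℂ) := by
    refine h2.congr fun n => ?_
    rw [LSeries.term_logMul_iterate_vonMangoldt]
    simp [MulChar.one_apply, Subsingleton.elim _ (1 : ZMod 1)]
  rw [Complex.summable_ofReal] at h3
  exact (summable_mul_left_iff (by positivity)).mp h3

/-- The sum of `Λ(n) χ(n) (log n)^k / (k! n^c)`. -/
noncomputable def twistedLogSum {N : ℕ} (c k : ℕ) (χ : DirichletCharacter ℂ N) : ℂ :=
  ∑' n : ℕ, (logWeight c k n : ℂ) * χ (n : ZMod N)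

theorem factorial_mul_twistedLogSum {N : ℕ} (χ : DirichletCharacter ℂ N) {c : ℕ} (hc : 2 ≤ c)
    (k : ℕ) : (k ! : ℂ) * twistedLogSum c k χ =
      (-1) ^ k * iteratedDeriv k
        (LSeries ((fun n : ℕ => χ (n : ZMod N)) * fun n : ℕ => (Λ n : ℂ))) c := by
  rw [LSeries_iteratedDeriv k (χ.abscissaOfAbsConv_twist_vonMangoldt_lt hc), ← mul_assoc,
    ← mul_pow, neg_one_mul, neg_neg, one_pow, one_mul, LSeries, twistedLogSum, ← tsum_mul_left]
  exact tsum_congr fun n =>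
    (LSeries.term_logMul_iterate_vonMangoldt c k n fun n : ℕ => χ (n : ZMod N)).symm

theorem norm_twistedLogSum_le {N : ℕ} (χ : DirichletCharacter ℂ N) {c : ℕ} (hc : 2 ≤ c) (k : ℕ) :
    ‖twistedLogSum c k χ‖ ≤ ∑' n, logWeight c k n := by
  refine tsum_of_norm_bounded (summable_logWeight hc k).hasSum fun n => ?_
  rw [norm_mul, Complex.norm_real, Real.norm_of_nonneg (logWeight_nonneg c k n)]
  exact mul_le_of_le_one_right (logWeight_nonneg c k n) (χ.norm_le_one _)

/-- Cauchy's estimate for `twistedLogSum` in terms of a bound for `L'/L` on a circle. -/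
theorem norm_twistedLogSum_le_of_norm_deriv_div_le {N : ℕ} [NeZero N]
    {χ : DirichletCharacter ℂ N} {F : ℂ → ℂ} {c : ℕ} (hc : 2 ≤ c) {r M : ℝ} (hr : 0 < r)
    (hF : DifferentiableOn ℂ F (closedBall (c : ℂ) r))
    (hFe : F =ᶠ[𝓝 (c : ℂ)] LSeries ((fun n : ℕ => χ (n : ZMod N)) * fun n : ℕ => (Λ n : ℂ)))
    (hM : ∀ z ∈ closedBall (c : ℂ) r, ‖F z‖ ≤ M) (k : ℕ) :
    ‖twistedLogSum c k χ‖ ≤ M / r ^ k := by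
  have h := norm_iteratedDeriv_le_of_forall_mem_sphere_norm_le (f := F) k hr
    ((hF.mono closure_ball_subset_closedBall).diffContOnCl)
    (fun z hz => hM z (sphere_subset_closedBall hz))
  have h2 := congrArg norm (factorial_mul_twistedLogSum χ hc k)
  rw [hFe.iteratedDeriv_eq] at h
  rw [norm_mul, norm_mul, norm_pow, norm_neg, norm_one, one_pow, one_mul,
    Complex.norm_natCast] at h2
  rw [← h2, mul_div_assoc] at h
  exact le_of_mul_le_mul_left h (by positivity)

theorem DirichletCharacter.one_fourth_le_norm_LFunction {N : ℕ} [NeZero N]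
    (χ : DirichletCharacter ℂ N)
    {c : ℕ} (hc : 2 ≤ c) : 1 / 4 ≤ ‖LFunction χ c‖ := by
  have hc1 : 1 < (c : ℂ).re := by simpa using (show 1 < c by omega)
  rw [LFunction_eq_LSeries χ hc1]
  have hs : Summable (LSeries.term (fun n : ℕ => χ (n : ZMod N)) c) :=
    χ.LSeriesSummable_of_one_lt_re hc1
  rw [LSeries, (hs.sum_add_tsum_nat_add 2).symm]
  have hz : Summable fun n : ℕ => 1 / ((n + 2 : ℕ) : ℝ) ^ 2 :=
    (summable_nat_add_iff 2).mpr hasSum_zeta_two.summable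
  have hz2 : ∑' n : ℕ, 1 / ((n + 2 : ℕ) : ℝ) ^ 2 = Real.pi ^ 2 / 6 - 1 := by
    rw [← hasSum_zeta_two.tsum_eq, ← hasSum_zeta_two.summable.sum_add_tsum_nat_add 2]
    simp [Finset.sum_range_succ]
  have ht : ‖∑' n : ℕ, LSeries.term (fun n : ℕ => χ (n : ZMod N)) c (n + 2)‖ ≤
      Real.pi ^ 2 / 6 - 1 := by
    refine tsum_of_norm_bounded (hz2 ▸ hz.hasSum) fun n => ?_
    rw [LSeries.term_of_ne_zero (by omega), norm_div, Complex.cpow_natCast, norm_pow,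
      Complex.norm_natCast]
    have h1 : (1 : ℝ) ≤ ((n + 2 : ℕ) : ℝ) := by push_cast; linarith [n.cast_nonneg (α := ℝ)]
    gcongr
    exact χ.norm_le_one _
  have hpi : Real.pi ^ 2 / 6 - 1 ≤ 3 / 4 := by nlinarith [Real.pi_lt_d2, Real.pi_pos]
  have h1 : ∑ i ∈ Finset.range 2, LSeries.term (fun n : ℕ => χ (n : ZMod N)) c i = 1 := by
    simp [Finset.sum_range_succ, LSeries.term]
  rw [h1]
  have := norm_sub_norm_le (1 : ℂ) (-∑' n : ℕ, LSeries.term (fun n : ℕ => χ (n : ZMod N)) c (n + 2))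
  rw [norm_one, norm_neg, sub_neg_eq_add] at this
  linarith

/-- Under GRH, the sums twisted by a nonprincipal character have a power saving in `exp k`. -/
theorem exists_norm_twistedLogSum_le_of_GRH : ∃ C : ℝ, 0 < C ∧ ∀ (p : ℕ) [Fact p.Prime]
    (χ : DirichletCharacter ℂ p), χ ≠ 1 →
    (∀ s : ℂ, DirichletCharacter.LFunction χ s = 0 → 0 < s.re → s.re < 1 → s.re = 1 / 2) →
    ∀ k : ℕ, ‖twistedLogSum 16 k χ‖ ≤ C * Real.log p / (309 / 20) ^ k := by
  refine ⟨8 * (31 / 2) / (31 / 2 - 309 / 20) ^ 2 * 9, by norm_num, fun p _ χ hχ hGRH k => ?_⟩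
  have hp : (2 : ℝ) ≤ p := mod_cast (Fact.out : p.Prime).two_le
  have hre : ∀ z ∈ ball (16 : ℂ) (31 / 2), 1 / 2 < z.re ∧ ‖z‖ ≤ 32 := by
    intro z hz
    rw [mem_ball, dist_eq_norm] at hz
    have h1 := (abs_le.mp ((abs_re_le_norm (z - 16)).trans hz.le)).1
    have h2 := (abs_lt.mp ((abs_re_le_norm (z - 16)).trans_lt hz)).1
    have h3 := norm_add_le (z - 16) 16
    rw [sub_add_cancel] at h3
    simp at h2 h3
    constructor <;> linarith
  have hne : ∀ z ∈ ball (16 : ℂ) (31 / 2), DirichletCharacter.LFunction χ z ≠ 0 := by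
    intro z hz h0
    have h1 := (hre z hz).1
    rcases lt_or_ge z.re 1 with h | h
    · linarith [hGRH z h0 (by linarith) h]
    · exact DirichletCharacter.LFunction_ne_zero_of_one_le_re χ (.inl hχ) h h0
  have hdiff := DirichletCharacter.differentiable_LFunction hχ
  have hbd : ∀ z ∈ ball (16 : ℂ) (31 / 2), ‖DirichletCharacter.LFunction χ z‖ ≤ 64 * p := by
    intro z hz
    obtain ⟨h1, h2⟩ := hre z hz
    refine (DirichletCharacter.norm_LFunction_le hχ (by linarith)).trans ?_
    calc ‖z‖ * (p / z.re) ≤ 32 * (p / (1 / 2)) := by gcongr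
      _ = 64 * p := by ring
  have hsub : closedBall (16 : ℂ) (309 / 20) ⊆ ball 16 (31 / 2) :=
    closedBall_subset_ball (by norm_num)
  have hlog : Real.log (64 * p / (1 / 4)) ≤ 9 * Real.log p := by
    rw [← Real.log_rpow (by linarith)]
    refine Real.log_le_log (by positivity) ?_
    have h8 : (2 : ℝ) ^ 8 ≤ p ^ 8 := by gcongr
    have : (p : ℝ) ^ (9 : ℝ) = p ^ 8 * p := by
      rw [show (9 : ℝ) = ((9 : ℕ) : ℝ) by norm_num, Real.rpow_natCast]; ring
    rw [this]
    nlinarith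
  have key := norm_twistedLogSum_le_of_norm_deriv_div_le (χ := χ) (c := 16) (r := 309 / 20)
    (M := 8 * (31 / 2) / (31 / 2 - 309 / 20) ^ 2 * (9 * Real.log p))
    (F := fun z => -(deriv (DirichletCharacter.LFunction χ) z / DirichletCharacter.LFunction χ z))
    (by norm_num) (by norm_num) ?_ ?_ ?_ k
  · refine key.trans (le_of_eq ?_)
    ring
  · refine DifferentiableOn.neg (DifferentiableOn.div ?_ hdiff.differentiableOn
      fun z hz => hne z (hsub (by exact_mod_cast hz)))
    exact (hdiff.differentiableOn.deriv isOpen_univ).mono (Set.subset_univ _)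
  · filter_upwards [(isOpen_lt continuous_const continuous_re).mem_nhds
        (show (1 : ℝ) < ((16 : ℕ) : ℂ).re by norm_num)] with z hz
    rw [χ.LSeries_twist_vonMangoldt_eq hz, DirichletCharacter.LFunction_eq_LSeries χ hz,
      DirichletCharacter.deriv_LFunction_eq_deriv_LSeries χ hz, neg_div]
  · intro z hz
    rw [norm_neg]
    refine (Complex.norm_deriv_div_le_of_ne_zero (r := 309 / 20) (R := 31 / 2) (c := 16)
      (by norm_num) (by norm_num)
      hdiff.differentiableOn hne hbd (by norm_num : (0 : ℝ) < 1 / 4)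
      (by exact_mod_cast χ.one_fourth_le_norm_LFunction (c := 16) (by norm_num)) (by linarith)
      (by exact_mod_cast hz)).trans ?_
    gcongr

theorem iteratedDeriv_inv_sub_const (k : ℕ) (a x : ℂ) :
    iteratedDeriv k (fun s => (s - a)⁻¹) x = (-1) ^ k * k ! / (x - a) ^ (k + 1) := by
  rw [iteratedDeriv_comp_sub_const k (fun s : ℂ => s⁻¹) a, iteratedDeriv_eq_iterate]
  simp only [iter_deriv_inv]
  rw [show (-1 - k : ℤ) = -((k + 1 : ℕ) : ℤ) by push_cast; ring, zpow_neg, zpow_natCast,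
    div_eq_mul_inv]

theorem tsum_logWeight_eq_twistedLogSum (c k : ℕ) :
    ((∑' n, logWeight c k n : ℝ) : ℂ) = twistedLogSum c k (1 : DirichletCharacter ℂ 1) := by
  rw [twistedLogSum, Complex.ofReal_tsum]
  refine tsum_congr fun n => ?_
  simp [MulChar.one_apply, Subsingleton.elim _ (1 : ZMod 1)]

theorem exists_abs_tsum_logWeight_sub_le {c : ℕ} (hc : 2 ≤ c) : ∃ R C : ℝ, (c : ℝ) - 1 < R ∧
    0 < C ∧ ∀ k, |∑' n, logWeight c k n - 1 / ((c : ℝ) - 1) ^ (k + 1)| ≤ C / R ^ k := by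
  have hc' : (2 : ℝ) ≤ c := mod_cast hc
  have hcre : 1 < (c : ℂ).re := by simpa using (show 1 < c by omega)
  set Z := DirichletCharacter.LFunctionTrivChar₁ 1 with hZ
  have hdiff : Differentiable ℂ Z := DirichletCharacter.differentiable_LFunctionTrivChar₁ 1
  have hZne : ∀ s : ℂ, 1 ≤ s.re → Z s ≠ 0 := by
    intro s hs
    rcases eq_or_ne s 1 with rfl | h1
    · exact DirichletCharacter.LFunctionTrivChar₁_apply_one_ne_zero 1
    · rw [hZ, DirichletCharacter.LFunctionTrivChar₁, Function.update_of_ne h1]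
      exact mul_ne_zero (sub_ne_zero.mpr h1)
        (DirichletCharacter.LFunction_ne_zero_of_one_le_re _ (.inr h1) hs)
  have hopen : IsOpen {s | Z s ≠ 0} := isOpen_ne_fun hdiff.continuous continuous_const
  obtain ⟨δ, hδ, hsub⟩ :=
    (isCompact_closedBall (c : ℂ) ((c : ℝ) - 1)).exists_cthickening_subset_open
    hopen (fun s hs => hZne s (by
      rw [mem_closedBall, dist_eq_norm] at hs
      have := (abs_le.mp ((abs_re_le_norm (s - c)).trans hs)).1
      simp at this
      linarith))
  rw [cthickening_closedBall hδ.le (by linarith)] at hsub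
  set R := δ + ((c : ℝ) - 1) with hR
  set G : ℂ → ℂ := fun s => -(deriv Z s / Z s) with hG
  have hGd : DifferentiableOn ℂ G (closedBall (c : ℂ) R) :=
    DifferentiableOn.neg <| .div
      ((hdiff.differentiableOn.deriv isOpen_univ).mono (Set.subset_univ _))
      hdiff.differentiableOn hsub
  obtain ⟨M, hM⟩ := (isCompact_closedBall (c : ℂ) R).exists_bound_of_continuousOn hGd.continuousOn
  have hRpos : 0 < R := by linarith
  refine ⟨R, max M 1, by linarith, by positivity, fun k => ?_⟩
  have heq : LSeries ((fun n : ℕ => (1 : DirichletCharacter ℂ 1) (n : ZMod 1)) *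
      fun n : ℕ => (Λ n : ℂ)) =ᶠ[𝓝 (c : ℂ)] (fun s => (s - 1)⁻¹) + G := by
    filter_upwards [(isOpen_lt continuous_const continuous_re).mem_nhds hcre] with s hs
    have hs1 : s ≠ 1 := by rintro rfl; simp at hs
    have hL : DirichletCharacter.LFunctionTrivChar 1 s ≠ 0 :=
      DirichletCharacter.LFunction_ne_zero_of_one_le_re _ (.inr hs1) hs.le
    have hs2 := sub_ne_zero.mpr hs1
    rw [DirichletCharacter.LSeries_twist_vonMangoldt_eq _ hs,
      ← DirichletCharacter.LFunction_eq_LSeries _ hs,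
      ← DirichletCharacter.deriv_LFunction_eq_deriv_LSeries _ hs, Pi.add_apply, hG]
    simp only [hZ]
    rw [DirichletCharacter.deriv_LFunctionTrivChar₁_apply_of_ne_one 1 hs1,
      DirichletCharacter.LFunctionTrivChar₁, Function.update_of_ne hs1]
    change -deriv (DirichletCharacter.LFunctionTrivChar 1) s /
      DirichletCharacter.LFunctionTrivChar 1 s = _
    field_simp
    ring
  have hcball : (c : ℂ) ∈ ball (c : ℂ) R := mem_ball_self hRpos
  have hGc : ContDiffAt ℂ k G c :=
    ((hGd.mono ball_subset_closedBall).contDiffOn isOpen_ball).contDiffAt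
      (isOpen_ball.mem_nhds hcball)
  have hc1 : (c : ℂ) - 1 ≠ 0 := sub_ne_zero.mpr (by exact_mod_cast (by omega : c ≠ 1))
  have hinv : ContDiffAt ℂ k (fun s : ℂ => (s - 1)⁻¹) c :=
    (contDiffAt_id.sub contDiffAt_const).inv hc1
  have h := factorial_mul_twistedLogSum (1 : DirichletCharacter ℂ 1) hc k
  rw [heq.iteratedDeriv_eq, iteratedDeriv_add hinv hGc, iteratedDeriv_inv_sub_const,
    ← tsum_logWeight_eq_twistedLogSum] at h
  have hcauchy := norm_iteratedDeriv_le_of_forall_mem_sphere_norm_le (f := G) k hRpos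
    ((hGd.mono closure_ball_subset_closedBall).diffContOnCl)
    (fun z hz => hM z (sphere_subset_closedBall hz))
  have hk : (k ! : ℂ) ≠ 0 := mod_cast k.factorial_ne_zero
  have h3 : (k ! : ℂ) * ((∑' n, logWeight c k n - 1 / ((c : ℝ) - 1) ^ (k + 1) : ℝ) : ℂ) =
      (-1) ^ k * iteratedDeriv k G c := by
    have hsq : ((-1 : ℂ)) ^ k * (-1) ^ k = 1 := by rw [← mul_pow]; simp
    push_cast
    push_cast at h
    rw [mul_sub, h, mul_add, mul_div_assoc, ← mul_assoc, hsq]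
    ring
  have h2 := congrArg norm h3
  rw [norm_mul, norm_mul, norm_pow, norm_neg, norm_one, one_pow, one_mul, Complex.norm_natCast,
    Complex.norm_real, Real.norm_eq_abs] at h2
  rw [← h2, mul_div_assoc] at hcauchy
  refine (le_of_mul_le_mul_left hcauchy (by positivity)).trans ?_
  gcongr
  exact le_max_left _ _

theorem exists_tsum_logWeight_le {c : ℕ} (hc : 2 ≤ c) : ∃ C : ℝ, 0 < C ∧
    ∀ k, ∑' n, logWeight c k n ≤ C / ((c : ℝ) - 1) ^ k := by
  obtain ⟨R, C, hR, hC, h⟩ := exists_abs_tsum_logWeight_sub_le hc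
  have hc' : (1 : ℝ) ≤ c - 1 := by
    have : (2 : ℝ) ≤ c := mod_cast hc
    linarith
  refine ⟨C + 1, by positivity, fun k => ?_⟩
  have h1 := (abs_le.mp (h k)).2
  have h2 : C / R ^ k ≤ C / ((c : ℝ) - 1) ^ k := by gcongr
  have h3 : 1 / ((c : ℝ) - 1) ^ (k + 1) ≤ 1 / ((c : ℝ) - 1) ^ k := by gcongr; simp
  rw [add_div]
  linarith

theorem eventually_le_tsum_logWeight {c : ℕ} (hc : 2 ≤ c) :
    ∀ᶠ k in atTop, 1 / (2 * ((c : ℝ) - 1)) / ((c : ℝ) - 1) ^ k ≤ ∑' n, logWeight c k n := by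
  obtain ⟨R, C, hR, hC, h⟩ := exists_abs_tsum_logWeight_sub_le hc
  have hc' : (1 : ℝ) ≤ c - 1 := by
    have : (2 : ℝ) ≤ c := mod_cast hc
    linarith
  have hR0 : 0 < R := by linarith
  have hlim : Tendsto (fun k : ℕ => C * (((c : ℝ) - 1) / R) ^ k) atTop (𝓝 (C * 0)) :=
    (tendsto_pow_atTop_nhds_zero_of_lt_one (by positivity) ((div_lt_one hR0).mpr hR)).const_mul C
  rw [mul_zero] at hlim
  filter_upwards [hlim.eventually_lt_const (show 0 < 1 / (2 * ((c : ℝ) - 1)) by positivity)]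
    with k hk
  have h1 := (abs_le.mp (h k)).1
  have h2 : C / R ^ k ≤ 1 / (2 * ((c : ℝ) - 1)) / ((c : ℝ) - 1) ^ k := by
    rw [le_div_iff₀ (by positivity)]
    rw [div_pow] at hk
    calc C / R ^ k * (c - 1) ^ k = C * ((c - 1) ^ k / R ^ k) := by ring
      _ ≤ _ := hk.le
  have h3 : 1 / ((c : ℝ) - 1) ^ (k + 1) = 2 * (1 / (2 * ((c : ℝ) - 1)) / ((c : ℝ) - 1) ^ k) := by
    field_simp
    ring
  linarith

theorem Summable.ite {α : Type*} {f : α → ℝ} (hf : Summable f) (h0 : ∀ n, 0 ≤ f n) (P : α → Prop)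
    [DecidablePred P] : Summable fun n => if P n then f n else 0 :=
  hf.of_nonneg_of_le (fun n => by split_ifs <;> simp [h0]) fun n => by split_ifs <;> simp [h0]

theorem logWeight_add_right (c d k n : ℕ) : logWeight (c + d) k n = logWeight c k n / n ^ d := by
  rw [logWeight, logWeight, pow_add, div_div, mul_assoc]

theorem tsum_ite_lt_logWeight_le {c : ℕ} (hc : 2 ≤ c) (d k : ℕ) {A : ℝ} (hA : 0 < A) :
    ∑' n : ℕ, (if A < n then logWeight (c + d) k n else 0) ≤ (∑' n, logWeight c k n) / A ^ d := by
  rw [← tsum_div_const]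
  refine Summable.tsum_le_tsum (fun n => ?_)
    ((summable_logWeight (by omega) k).ite (logWeight_nonneg _ k) _)
    ((summable_logWeight hc k).div_const _)
  have := logWeight_nonneg c k n
  split_ifs with h
  · rw [logWeight_add_right]
    gcongr
  · positivity

/-- The mass of the weight beyond `(103/100)^(3k)` is relatively small. -/
theorem exists_tail_le : ∃ C : ℝ, 0 < C ∧ ∀ᶠ k in atTop,
    ∑' n : ℕ, (if ((103 / 100 : ℝ) ^ k) ^ 3 < n then logWeight 16 k n else 0) ≤
      C / (103 / 100) ^ k * ∑' n, logWeight 16 k n := by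
  obtain ⟨C, hC, h⟩ := exists_tsum_logWeight_le (c := 11) (by norm_num)
  refine ⟨C * 30, by positivity, ?_⟩
  filter_upwards [eventually_le_tsum_logWeight (c := 16) (by norm_num)] with k hk
  refine (tsum_ite_lt_logWeight_le (c := 11) (by norm_num) 5 k (by positivity)).trans ?_
  have h1 := h k
  norm_num at h1 hk
  have h2 : (15 : ℝ) ^ k ≤ 10 ^ k * ((103 / 100 : ℝ) ^ k) ^ 14 := by
    rw [← pow_mul, mul_comm k, pow_mul, ← mul_pow]
    gcongr
    norm_num
  calc (∑' n, logWeight 11 k n) / (((103 / 100 : ℝ) ^ k) ^ 3) ^ 5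
      ≤ C / 10 ^ k / (((103 / 100 : ℝ) ^ k) ^ 3) ^ 5 := by gcongr
    _ = C / (103 / 100) ^ k * (1 / (10 ^ k * ((103 / 100 : ℝ) ^ k) ^ 14)) := by
        field_simp
    _ ≤ C / (103 / 100) ^ k * (1 / 15 ^ k) := by gcongr
    _ = C * 30 / (103 / 100) ^ k * (1 / 30 / 15 ^ k) := by field_simp
    _ ≤ _ := by gcongr

theorem logWeight_prime_pow_le {p : ℕ} (hp : p.Prime) (c k j : ℕ) :
    logWeight (c + 2) k (p ^ (j + 1)) ≤ Real.log p / (c + 1) ^ k / p ^ (j + 1) := by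
  have hp0 : (0 : ℝ) < p := mod_cast hp.pos
  have hlog : 0 ≤ Real.log p := Real.log_natCast_nonneg p
  rw [logWeight, ArithmeticFunction.vonMangoldt_apply_pow (by omega),
    ArithmeticFunction.vonMangoldt_apply_prime hp]
  have h1 := Real.pow_div_factorial_le_exp ((c + 1) * Real.log ((p ^ (j + 1) : ℕ))) (by
    have := Real.log_natCast_nonneg (p ^ (j + 1)); positivity) k
  have h2 : Real.exp ((c + 1) * Real.log ((p ^ (j + 1) : ℕ))) = (p ^ (j + 1) : ℝ) ^ (c + 1) := by
    rw [mul_comm, Real.exp_mul, Real.exp_log (by exact_mod_cast pow_pos hp.pos _)]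
    norm_cast
  rw [h2, mul_pow] at h1
  have hpj : (0 : ℝ) < (p : ℝ) ^ (j + 1) := by positivity
  push_cast at h1 ⊢
  set x := Real.log ((p : ℝ) ^ (j + 1)) with hx
  set P := (p : ℝ) ^ (j + 1) with hP
  calc Real.log p * x ^ k / (k ! * P ^ (c + 2))
      = Real.log p / (c + 1) ^ k * (((c + 1) ^ k * x ^ k / k !) / P ^ (c + 2)) := by field_simp
    _ ≤ Real.log p / (c + 1) ^ k * (P ^ (c + 1) / P ^ (c + 2)) := by gcongr
    _ = _ := by field_simp; ring

theorem tsum_ite_dvd_logWeight_le {p : ℕ} (hp : p.Prime) (c k : ℕ) :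
    ∑' n : ℕ, (if p ∣ n then logWeight (c + 2) k n else 0) ≤
      Real.log p / (p - 1) / (c + 1) ^ k := by
  have hp2 : (2 : ℝ) ≤ p := mod_cast hp.two_le
  have hinj : Function.Injective fun j : ℕ => p ^ (j + 1) := fun a b h => by
    simpa using Nat.pow_right_injective hp.two_le h
  have hsupp : (Function.support fun n : ℕ => if p ∣ n then logWeight (c + 2) k n else 0) ⊆
      Set.range fun j : ℕ => p ^ (j + 1) := by
    intro n hn
    simp only [Function.mem_support, ne_eq, ite_eq_right_iff, Classical.not_imp] at hn
    obtain ⟨hd, hn⟩ := hn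
    have hΛ : Λ n ≠ 0 := fun h => hn (by rw [logWeight, h, zero_mul, zero_div])
    rw [ArithmeticFunction.vonMangoldt_ne_zero_iff, isPrimePow_nat_iff] at hΛ
    obtain ⟨q, i, hq, hi, rfl⟩ := hΛ
    obtain rfl := (Nat.prime_dvd_prime_iff_eq hp hq).mp (hp.dvd_of_dvd_pow hd)
    exact ⟨i - 1, by simp [Nat.sub_add_cancel hi]⟩
  rw [← hinj.tsum_eq hsupp]
  have hr1 : (p : ℝ)⁻¹ < 1 := inv_lt_one_of_one_lt₀ (by linarith)
  have hgeo := (hasSum_geometric_of_lt_one (by positivity) hr1).mul_left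
    (Real.log p / (c + 1) ^ k * (p : ℝ)⁻¹)
  have hval : Real.log p / (c + 1) ^ k * (p : ℝ)⁻¹ * (1 - (p : ℝ)⁻¹)⁻¹ =
      Real.log p / (p - 1) / (c + 1) ^ k := by
    have : (p : ℝ) - 1 ≠ 0 := by linarith
    have : 1 - (p : ℝ)⁻¹ ≠ 0 := by linarith
    field_simp
  rw [hval] at hgeo
  have hle : ∀ j : ℕ, (if p ∣ p ^ (j + 1) then logWeight (c + 2) k (p ^ (j + 1)) else 0) ≤
      Real.log p / (c + 1) ^ k * (p : ℝ)⁻¹ * (p : ℝ)⁻¹ ^ j := by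
    intro j
    rw [if_pos (dvd_pow_self p (by omega))]
    refine (logWeight_prime_pow_le hp c k j).trans (le_of_eq ?_)
    rw [pow_succ, inv_pow]
    field_simp
  rw [← hgeo.tsum_eq]
  refine Summable.tsum_le_tsum hle (hgeo.summable.of_nonneg_of_le (fun j => ?_) hle) hgeo.summable
  split_ifs
  exacts [logWeight_nonneg _ _ _, le_rfl]

theorem tendsto_log_div_sub_one : Tendsto (fun x : ℝ => Real.log x / (x - 1)) atTop (𝓝 0) := by
  have h := Real.tendsto_pow_log_div_mul_add_atTop 1 (-1) 1 one_ne_zero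
  simpa [sub_eq_add_neg] using h

/-- For large primes `p`, at most half of the mass of the weight lies on multiples of `p`. -/
theorem exists_tsum_ite_dvd_logWeight_le : ∃ p₀ : ℕ, ∀ᶠ k in atTop, ∀ p : ℕ, p.Prime → p₀ ≤ p →
    ∑' n : ℕ, (if p ∣ n then logWeight 16 k n else 0) ≤ (∑' n, logWeight 16 k n) / 2 := by
  have h := (tendsto_log_div_sub_one.comp tendsto_natCast_atTop_atTop).eventually_lt_const
    (show (0 : ℝ) < 1 / 60 by norm_num)
  obtain ⟨p₀, hp₀⟩ := eventually_atTop.mp h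
  refine ⟨p₀, ?_⟩
  filter_upwards [eventually_le_tsum_logWeight (c := 16) (by norm_num)] with k hk p hp hpp
  refine (tsum_ite_dvd_logWeight_le hp 14 k).trans ?_
  have h1 := hp₀ p hpp
  simp only [Function.comp_apply] at h1
  norm_num at hk ⊢
  calc Real.log p / (p - 1) / 15 ^ k ≤ 1 / 60 / 15 ^ k := by gcongr
    _ = 1 / 30 / 15 ^ k / 2 := by ring
    _ ≤ _ := by gcongr

theorem squarefull_sq_mul_cube (a b : ℕ) : Squarefull (a ^ 2 * b ^ 3) := by
  intro q hq h
  rcases (hq.dvd_mul).mp h with h | h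
  · exact (pow_dvd_pow_of_dvd (hq.dvd_of_dvd_pow h) 2).mul_right _
  · exact ((pow_dvd_pow_of_dvd (hq.dvd_of_dvd_pow h) 2).trans
      (pow_dvd_pow b (by norm_num))).mul_left _

namespace DirichletCharacter

variable {p : ℕ} [Fact p.Prime]

theorem norm_sum_coeff_mul_sub_le {c : DirichletCharacter ℂ p → ℂ} {d M : ℝ} (hc : ∀ χ, ‖c χ‖ ≤ d)
    (hM : ∑ χ, ‖c χ‖ ≤ M) {T₁ T₂ : DirichletCharacter ℂ p → ℂ} {W₁ W₂ E₁ E₂ : ℝ}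
    (hE₁ : 0 ≤ E₁) (hE₂ : 0 ≤ E₂)
    (hW₁ : ∀ χ, ‖T₁ χ‖ ≤ W₁) (hT₁ : ∀ χ, χ ≠ 1 → ‖T₁ χ‖ ≤ E₁)
    (hW₂ : ∀ χ, ‖T₂ χ‖ ≤ W₂) (hT₂ : ∀ χ, χ ≠ 1 → ‖T₂ χ‖ ≤ E₂) :
    ‖∑ χ, c χ * (T₁ (χ ^ 2) * T₂ (χ ^ 3)) - c 1 * (T₁ 1 * T₂ 1)‖ ≤
      d * (2 * (W₁ * E₂) + 3 * (E₁ * W₂)) + M * (E₁ * E₂) := by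
  classical
  have hd : 0 ≤ d := (norm_nonneg _).trans (hc 1)
  have hW₁0 : 0 ≤ W₁ := (norm_nonneg _).trans (hW₁ 1)
  have hW₂0 : 0 ≤ W₂ := (norm_nonneg _).trans (hW₂ 1)
  set t : DirichletCharacter ℂ p → ℝ := fun χ => (if χ ^ 2 = 1 then d * (W₁ * E₂) else 0) +
    (if χ ^ 3 = 1 then d * (E₁ * W₂) else 0) + ‖c χ‖ * (E₁ * E₂) with ht
  have ht0 : ∀ χ, 0 ≤ t χ := fun χ => by
    simp only [ht]
    split_ifs <;> positivity
  have hterm : ∀ χ ≠ 1, ‖c χ * (T₁ (χ ^ 2) * T₂ (χ ^ 3))‖ ≤ t χ := by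
    intro χ hχ
    have hcχ : 0 ≤ ‖c χ‖ * (E₁ * E₂) := by positivity
    have h3 : 0 ≤ if χ ^ 3 = 1 then d * (E₁ * W₂) else 0 := by split_ifs <;> positivity
    rw [norm_mul, norm_mul]
    by_cases h2 : χ ^ 2 = 1
    · have h3' : χ ^ 3 ≠ 1 := by rwa [pow_succ, h2, one_mul]
      have : ‖c χ‖ * (‖T₁ (χ ^ 2)‖ * ‖T₂ (χ ^ 3)‖) ≤ d * (W₁ * E₂) := by
        gcongr
        exacts [hc χ, hW₁ _, hT₂ _ h3']
      simp only [ht, if_pos h2]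
      linarith
    by_cases h3' : χ ^ 3 = 1
    · have : ‖c χ‖ * (‖T₁ (χ ^ 2)‖ * ‖T₂ (χ ^ 3)‖) ≤ d * (E₁ * W₂) := by
        gcongr
        exacts [hc χ, hT₁ _ h2, hW₂ _]
      simp only [ht, if_pos h3', if_neg h2]
      linarith
    · simp only [ht, if_neg h3', if_neg h2, zero_add]
      gcongr
      exacts [hT₁ _ h2, hT₂ _ h3']
  have hsub : ∑ χ, c χ * (T₁ (χ ^ 2) * T₂ (χ ^ 3)) - c 1 * (T₁ 1 * T₂ 1) =
      ∑ χ ∈ Finset.univ.erase 1, c χ * (T₁ (χ ^ 2) * T₂ (χ ^ 3)) := by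
    rw [← Finset.add_sum_erase _ _ (Finset.mem_univ (1 : DirichletCharacter ℂ p)), one_pow, one_pow]
    ring
  have hcard : ∀ n : ℕ, 0 < n → ∀ e : ℝ, 0 ≤ e →
      ∑ χ : DirichletCharacter ℂ p, (if χ ^ n = 1 then e else 0) ≤ n * e := by
    intro n hn e he
    rw [← Finset.sum_filter, Finset.sum_const, nsmul_eq_mul]
    gcongr
    exact card_filter_pow_eq_one_le hn
  rw [hsub]
  calc _ ≤ ∑ χ ∈ Finset.univ.erase 1, t χ :=
        (norm_sum_le _ _).trans (Finset.sum_le_sum fun χ hχ => hterm χ (Finset.ne_of_mem_erase hχ))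
    _ ≤ ∑ χ, t χ := Finset.sum_le_univ_sum_of_nonneg ht0
    _ ≤ 2 * (d * (W₁ * E₂)) + 3 * (d * (E₁ * W₂)) + M * (E₁ * E₂) := by
        simp only [ht]
        rw [Finset.sum_add_distrib, Finset.sum_add_distrib, ← Finset.sum_mul]
        have h2 := hcard 2 (by norm_num) (d * (W₁ * E₂)) (by positivity)
        have h3 := hcard 3 (by norm_num) (d * (E₁ * W₂)) (by positivity)
        push_cast at h2 h3
        gcongr
    _ = _ := by ring

end DirichletCharacter

theorem summable_logWeight_mul_char {N c : ℕ} (hc : 2 ≤ c) (k : ℕ) (χ : DirichletCharacter ℂ N) :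
    Summable fun n : ℕ => ‖(logWeight c k n : ℂ) * χ (n : ZMod N)‖ := by
  refine (summable_logWeight hc k).of_nonneg_of_le (fun _ => norm_nonneg _) fun n => ?_
  rw [norm_mul, Complex.norm_real, Real.norm_of_nonneg (logWeight_nonneg c k n)]
  exact mul_le_of_le_one_right (logWeight_nonneg c k n) (χ.norm_le_one _)

theorem twistedLogSum_one {p : ℕ} [Fact p.Prime] {c : ℕ} (hc : 2 ≤ c) (k : ℕ) :
    twistedLogSum c k (1 : DirichletCharacter ℂ p) =
      ((∑' n, logWeight c k n - ∑' n : ℕ, (if p ∣ n then logWeight c k n else 0) : ℝ) : ℂ) := by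
  rw [twistedLogSum, ← (summable_logWeight hc k).tsum_sub
    ((summable_logWeight hc k).ite (logWeight_nonneg c k) _), Complex.ofReal_tsum]
  refine tsum_congr fun n => ?_
  split_ifs with h
  · rw [(ZMod.natCast_eq_zero_iff n p).mpr h, MulChar.map_zero]
    simp
  · rw [MulChar.one_apply (isUnit_iff_ne_zero.mpr ((ZMod.natCast_eq_zero_iff n p).not.mpr h))]
    simp

/-- The weighted number of pairs `(a, b)` for which `a² b³` is a primitive root. -/
noncomputable def weightedCount (p c k₁ k₂ : ℕ) : ℝ :=
  ∑' x : ℕ × ℕ, logWeight c k₁ x.1 * logWeight c k₂ x.2 *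
    if orderOf ((x.1 ^ 2 * x.2 ^ 3 : ℕ) : ZMod p) = p - 1 then 1 else 0

theorem weightedCount_eq_sum {p : ℕ} [Fact p.Prime] {c : ℕ} (hc : 2 ≤ c) (k₁ k₂ : ℕ)
    {e : DirichletCharacter ℂ p → ℂ}
    (he : ∀ x : ZMod p, ∑ χ, e χ * χ x = if orderOf x = p - 1 then 1 else 0) :
    (weightedCount p c k₁ k₂ : ℂ) =
      ∑ χ, e χ * (twistedLogSum c k₁ (χ ^ 2) * twistedLogSum c k₂ (χ ^ 3)) := by
  have hs (χ : DirichletCharacter ℂ p) : HasSum (fun x : ℕ × ℕ => e χ *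
      ((logWeight c k₁ x.1 * (χ ^ 2) (x.1 : ZMod p)) *
        (logWeight c k₂ x.2 * (χ ^ 3) (x.2 : ZMod p))))
      (e χ * (twistedLogSum c k₁ (χ ^ 2) * twistedLogSum c k₂ (χ ^ 3))) := by
    have h₁ := summable_logWeight_mul_char hc k₁ (χ ^ 2)
    have h₂ := summable_logWeight_mul_char hc k₂ (χ ^ 3)
    rw [twistedLogSum, twistedLogSum, tsum_mul_tsum_of_summable_norm h₁ h₂]
    exact (summable_mul_of_summable_norm h₁ h₂).hasSum.mul_left (e χ)
  rw [← (hasSum_sum fun χ _ => hs χ).tsum_eq, weightedCount, Complex.ofReal_tsum]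
  refine tsum_congr fun x => ?_
  have h := he ((x.1 ^ 2 * x.2 ^ 3 : ℕ) : ZMod p)
  push_cast at h ⊢
  rw [apply_ite Complex.ofReal, Complex.ofReal_one, Complex.ofReal_zero, ← h, Finset.mul_sum]
  refine Finset.sum_congr rfl fun χ _ => ?_
  rw [map_mul, map_pow, map_pow, MulChar.pow_apply' _ two_ne_zero,
    MulChar.pow_apply' _ three_ne_zero]
  ring

theorem weightedCount_le {p c : ℕ} (hc : 2 ≤ c) (k₁ k₂ : ℕ) {A B : ℝ}
    (h : ∀ a b : ℕ, a ≤ A → b ≤ B → orderOf ((a ^ 2 * b ^ 3 : ℕ) : ZMod p) ≠ p - 1) :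
    weightedCount p c k₁ k₂ ≤
      (∑' n : ℕ, (if A < n then logWeight c k₁ n else 0)) * (∑' n, logWeight c k₂ n) +
      (∑' n, logWeight c k₁ n) * ∑' n : ℕ, (if B < n then logWeight c k₂ n else 0) := by
  have hs (k : ℕ) : Summable fun n => ‖logWeight c k n‖ := (summable_logWeight hc k).norm
  have hi (k : ℕ) (X : ℝ) : Summable fun n : ℕ => ‖if X < n then logWeight c k n else 0‖ :=
    ((summable_logWeight hc k).ite (logWeight_nonneg c k) _).norm
  have h1 := summable_mul_of_summable_norm (hi k₁ A) (hs k₂)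
  have h2 := summable_mul_of_summable_norm (hs k₁) (hi k₂ B)
  rw [tsum_mul_tsum_of_summable_norm (hi k₁ A) (hs k₂),
    tsum_mul_tsum_of_summable_norm (hs k₁) (hi k₂ B), ← h1.tsum_add h2, weightedCount]
  have hle : ∀ x : ℕ × ℕ, logWeight c k₁ x.1 * logWeight c k₂ x.2 *
      (if orderOf ((x.1 ^ 2 * x.2 ^ 3 : ℕ) : ZMod p) = p - 1 then 1 else 0) ≤
      (if A < x.1 then logWeight c k₁ x.1 else 0) * logWeight c k₂ x.2 +
        logWeight c k₁ x.1 * (if B < x.2 then logWeight c k₂ x.2 else 0) := by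
    intro x
    have hw₁ := logWeight_nonneg c k₁ x.1
    have hw₂ := logWeight_nonneg c k₂ x.2
    have hw := mul_nonneg hw₁ hw₂
    by_cases hA : A < x.1 <;> by_cases hB : B < x.2
    · simp only [hA, hB, if_true]
      split_ifs <;> linarith
    · simp only [hA, hB, if_true, if_false]
      split_ifs <;> linarith
    · simp only [hA, hB, if_true, if_false]
      split_ifs <;> linarith
    · rw [if_neg (h _ _ (not_lt.mp hA) (not_lt.mp hB))]
      simp [hA, hB]
  refine Summable.tsum_le_tsum hle ((h1.add h2).of_nonneg_of_le (fun x => ?_) hle) (h1.add h2)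
  have hw := mul_nonneg (logWeight_nonneg c k₁ x.1) (logWeight_nonneg c k₂ x.2)
  split_ifs <;> simp [hw]

theorem exists_orderOf_sq_mul_cube_eq {p : ℕ} [Fact p.Prime] (hp : 3 ≤ p) {c k₁ k₂ : ℕ}
    (hc : 2 ≤ c) {A B : ℝ} (hpos : ∀ k ∈ ({k₁, k₂} : Set ℕ), 0 < ∑' n, logWeight c k n ∧
      ∑' n : ℕ, (if p ∣ n then logWeight c k n else 0) ≤ (∑' n, logWeight c k n) / 2)
    (h₁ : ∀ χ : DirichletCharacter ℂ p, χ ≠ 1 → ‖twistedLogSum c k₁ χ‖ ≤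
      (∑' n, logWeight c k₁ n) / (64 * 2 ^ (p - 1).primeFactors.card))
    (h₂ : ∀ χ : DirichletCharacter ℂ p, χ ≠ 1 → ‖twistedLogSum c k₂ χ‖ ≤
      (∑' n, logWeight c k₂ n) / 64)
    (hA : ∑' n : ℕ, (if A < n then logWeight c k₁ n else 0) ≤
      1 / ((p - 1).primeFactors.card + 1) / 32 * ∑' n, logWeight c k₁ n)
    (hB : ∑' n : ℕ, (if B < n then logWeight c k₂ n else 0) ≤
      1 / ((p - 1).primeFactors.card + 1) / 32 * ∑' n, logWeight c k₂ n) :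
    ∃ a b : ℕ, (a : ℝ) ≤ A ∧ (b : ℝ) ≤ B ∧ orderOf ((a ^ 2 * b ^ 3 : ℕ) : ZMod p) = p - 1 := by
  by_contra! hcon
  have hle := weightedCount_le (p := p) hc k₁ k₂ hcon
  obtain ⟨e, d, hd, he1, hed, hesum, hex⟩ :=
    DirichletCharacter.exists_charExpansion_primitiveRoot hp
  obtain ⟨hW₁, hP₁⟩ := hpos k₁ (by simp)
  obtain ⟨hW₂, hP₂⟩ := hpos k₂ (by simp)
  have hd0 : 0 < d := lt_of_lt_of_le (by positivity) hd
  have hmain := DirichletCharacter.norm_sum_coeff_mul_sub_le hed hesum (by positivity)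
    (by positivity) (norm_twistedLogSum_le · hc k₁) h₁ (norm_twistedLogSum_le · hc k₂) h₂
  rw [← weightedCount_eq_sum hc k₁ k₂ hex, twistedLogSum_one hc, twistedLogSum_one hc, he1,
    ← Complex.ofReal_mul, ← Complex.ofReal_mul, ← Complex.ofReal_sub, Complex.norm_real,
    Real.norm_eq_abs] at hmain
  have hmain' := (abs_le.mp hmain).1
  set W₁ := ∑' n, logWeight c k₁ n
  set W₂ := ∑' n, logWeight c k₂ n
  set m : ℝ := 2 ^ (p - 1).primeFactors.card with hm
  have hm1 : 1 ≤ m := one_le_pow₀ (by norm_num)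
  have hpr : W₁ / 2 * (W₂ / 2) ≤ (W₁ - ∑' n : ℕ, (if p ∣ n then logWeight c k₁ n else 0)) *
      (W₂ - ∑' n : ℕ, (if p ∣ n then logWeight c k₂ n else 0)) :=
    mul_le_mul (by linarith) (by linarith) (by positivity) (by linarith)
  have hpr' := mul_le_mul_of_nonneg_left hpr hd0.le
  have herr : d * (2 * (W₁ * (W₂ / 64)) + 3 * (W₁ / (64 * m) * W₂)) +
      m * d * (W₁ / (64 * m) * (W₂ / 64)) ≤ d * (W₁ * W₂) / 8 := by
    have e1 : W₁ / (64 * m) ≤ W₁ / 64 := by gcongr; linarith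
    have e2 : m * d * (W₁ / (64 * m) * (W₂ / 64)) = d * (W₁ * W₂) / 4096 := by field_simp; norm_num
    have e3 : d * (2 * (W₁ * (W₂ / 64)) + 3 * (W₁ / (64 * m) * W₂)) ≤
        d * (2 * (W₁ * (W₂ / 64)) + 3 * (W₁ / 64 * W₂)) := by gcongr
    have e4 : 0 < d * (W₁ * W₂) := by positivity
    rw [e2]
    linarith
  have htail : 1 / ((p - 1).primeFactors.card + 1) / 32 ≤ d / 32 := by gcongr
  have hA' := mul_le_mul_of_nonneg_right (hA.trans (mul_le_mul_of_nonneg_right htail hW₁.le)) hW₂.le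
  have hB' := mul_le_mul_of_nonneg_left (hB.trans (mul_le_mul_of_nonneg_right htail hW₂.le)) hW₁.le
  have : 0 < d * (W₁ * W₂) := by positivity
  linarith

theorem exists_squarefull_primitiveRoot_le_pow (p : ℕ) [Fact p.Prime] :
    ∃ g : ℕ, 1 ≤ g ∧ Squarefull g ∧ orderOf (g : ZMod p) = p - 1 ∧ g ≤ p ^ 5 := by
  obtain ⟨u, hu⟩ := IsCyclic.exists_generator (α := (ZMod p)ˣ)
  have huo : orderOf (u : ZMod p) = p - 1 := by
    rw [orderOf_units, orderOf_eq_card_of_forall_mem_zpowers hu, Nat.card_eq_fintype_card,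
      ZMod.card_units]
  have hcast : (((u⁻¹ : (ZMod p)ˣ).val.val ^ 2 * u.val.val ^ 3 : ℕ) : ZMod p) = u := by
    push_cast
    rw [ZMod.natCast_zmod_val, ZMod.natCast_zmod_val, pow_succ _ 2, ← mul_assoc, ← mul_pow,
      inv_mul_cancel₀ u.ne_zero, one_pow, one_mul]
  refine ⟨_, ?_, squarefull_sq_mul_cube _ _, by rw [hcast, huo], ?_⟩
  · rw [Nat.one_le_iff_ne_zero]
    intro h0
    rw [h0, Nat.cast_zero] at hcast
    exact u.ne_zero hcast.symm
  · calc _ ≤ p ^ 2 * p ^ 3 := by gcongr <;> exact (ZMod.val_lt _).le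
      _ = p ^ 5 := by ring

theorem three_halves_le_log {p : ℕ} (hp : 5 ≤ p) : 3 / 2 ≤ Real.log p := by
  rw [Real.le_log_iff_exp_le (by positivity)]
  have hp' : (5 : ℝ) ≤ p := mod_cast hp
  refine le_trans ?_ hp'
  have h1 := Real.exp_one_lt_d9
  have h3 : Real.exp (3 / 2) ^ 2 = Real.exp 1 ^ 3 := by
    rw [← Real.exp_nat_mul, ← Real.exp_nat_mul]
    norm_num
  have h4 : Real.exp 1 ^ 3 ≤ 2.72 ^ 3 := by gcongr; linarith
  have h5 : Real.exp (3 / 2) ^ 2 ≤ 5 ^ 2 := h3.trans_le (h4.trans (by norm_num))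
  exact le_of_sq_le_sq h5 (by norm_num)

theorem card_primeFactors_add_one_le_log {p : ℕ} (hp : 5 ≤ p) :
    ((p - 1).primeFactors.card : ℝ) + 1 ≤ 3 * Real.log p := by
  have h1 : 2 ^ (p - 1).primeFactors.card ≤ p - 1 :=
    (Finset.pow_card_le_prod _ _ _ fun q hq => (Nat.prime_of_mem_primeFactors hq).two_le).trans
      (Nat.le_of_dvd (by omega) (Nat.prod_primeFactors_dvd _))
  have h2 : (2 : ℝ) ^ (p - 1).primeFactors.card ≤ p := by exact_mod_cast h1.trans (Nat.sub_le _ _)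
  have h3 := Real.log_le_log (by positivity) h2
  rw [Real.log_pow] at h3
  have h4 := Real.log_two_gt_d9
  have h5 := three_halves_le_log hp
  have h6 : (0 : ℝ) ≤ (p - 1).primeFactors.card := by positivity
  nlinarith

theorem exists_le_pow_le {X : ℝ} (hX : 1 ≤ X) :
    ∃ k : ℕ, X ≤ (103 / 100 : ℝ) ^ k ∧ (103 / 100 : ℝ) ^ k ≤ 2 * X := by
  obtain ⟨n, h1, h2⟩ := exists_nat_pow_near hX (show (1 : ℝ) < 103 / 100 by norm_num)
  refine ⟨n + 1, h2.le, ?_⟩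
  rw [pow_succ]
  linarith

/-- Under GRH modulo a large prime `p`, a square-full primitive root can be found among the
`a² b³` with `a` and `b` small. -/
theorem exists_squarefull_primitiveRoot_le_of_GRH : ∃ (p₀ : ℕ) (K : ℝ), 1 ≤ K ∧
    ∀ (p : ℕ) [Fact p.Prime], 5 ≤ p → p₀ ≤ p →
      (∀ ψ : DirichletCharacter ℂ p, ∀ s : ℂ,
        DirichletCharacter.LFunction ψ s = 0 → 0 < s.re → s.re < 1 → s.re = 1 / 2) →
      ∃ a b : ℕ, (a : ℝ) ≤ (2 * (K * 2 ^ (p - 1).primeFactors.card * Real.log p)) ^ 3 ∧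
        (b : ℝ) ≤ (2 * (K * Real.log p)) ^ 3 ∧
        orderOf ((a ^ 2 * b ^ 3 : ℕ) : ZMod p) = p - 1 := by
  obtain ⟨C₁, hC₁, h₁⟩ := exists_norm_twistedLogSum_le_of_GRH
  obtain ⟨C₂, hC₂, h₂⟩ := exists_tail_le
  obtain ⟨p₀, h₃⟩ := exists_tsum_ite_dvd_logWeight_le
  obtain ⟨k₀, hk₀⟩ := eventually_atTop.mp
    ((h₂.and h₃).and (eventually_le_tsum_logWeight (c := 16) (by norm_num)))
  have hQ : (1 : ℝ) ≤ (103 / 100) ^ k₀ := one_le_pow₀ (by norm_num)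
  refine ⟨p₀, 1920 * C₁ + 96 * C₂ + (103 / 100) ^ k₀, by linarith, fun p _ hp5 hp hGRH => ?_⟩
  set K := 1920 * C₁ + 96 * C₂ + (103 / 100 : ℝ) ^ k₀ with hK
  have hlog := three_halves_le_log hp5
  have hω := card_primeFactors_add_one_le_log hp5
  set m : ℝ := 2 ^ (p - 1).primeFactors.card with hm
  have hm1 : 1 ≤ m := one_le_pow₀ (by norm_num)
  have hKlog : (103 / 100 : ℝ) ^ k₀ ≤ K * Real.log p := by nlinarith
  have hKm : K * Real.log p ≤ K * m * Real.log p := by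
    rw [mul_right_comm]
    exact le_mul_of_one_le_right (by linarith) hm1
  have hstep : ∀ k : ℕ, K * Real.log p ≤ (103 / 100) ^ k →
      (0 < ∑' n, logWeight 16 k n ∧ ∑' n : ℕ, (if p ∣ n then logWeight 16 k n else 0) ≤
        (∑' n, logWeight 16 k n) / 2) ∧
      (∀ M : ℝ, 0 < M → K * M * Real.log p ≤ (103 / 100) ^ k →
        ∀ χ : DirichletCharacter ℂ p, χ ≠ 1 →
          ‖twistedLogSum 16 k χ‖ ≤ (∑' n, logWeight 16 k n) / (64 * M)) ∧
      ∑' n : ℕ, (if ((103 / 100 : ℝ) ^ k) ^ 3 < n then logWeight 16 k n else 0) ≤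
        1 / ((p - 1).primeFactors.card + 1) / 32 * ∑' n, logWeight 16 k n := by
    intro k hk
    have hkk : k₀ ≤ k := (pow_le_pow_iff_right₀ (by norm_num : (1 : ℝ) < 103 / 100)).mp
      (hKlog.trans hk)
    obtain ⟨⟨htail, hdvd⟩, hW⟩ := hk₀ k hkk
    norm_num at hW
    have hWpos : 0 < ∑' n, logWeight 16 k n := lt_of_lt_of_le (by positivity) hW
    refine ⟨⟨hWpos, hdvd p Fact.out hp⟩, fun M hM hMk χ hχ => ?_, htail.trans ?_⟩
    · refine (h₁ p χ hχ (hGRH χ) k).trans ?_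
      have h15 : (309 / 20 : ℝ) ^ k = 15 ^ k * (103 / 100) ^ k := by
        rw [← mul_pow]; norm_num
      have hle : 1920 * C₁ * M * Real.log p ≤ (103 / 100) ^ k :=
        le_trans (by gcongr; linarith) hMk
      rw [h15]
      calc C₁ * Real.log p / (15 ^ k * (103 / 100) ^ k)
          ≤ C₁ * Real.log p / (15 ^ k * (1920 * C₁ * M * Real.log p)) := by gcongr
        _ = 1 / 30 / 15 ^ k / (64 * M) := by field_simp; norm_num
        _ ≤ _ := by gcongr
    · refine mul_le_mul_of_nonneg_right ?_ hWpos.le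
      have hle : 96 * C₂ * Real.log p ≤ (103 / 100) ^ k :=
        le_trans (by gcongr; linarith) hk
      calc C₂ / (103 / 100) ^ k ≤ C₂ / (96 * C₂ * Real.log p) := by gcongr
        _ = 1 / (3 * Real.log p) / 32 := by field_simp; norm_num
        _ ≤ _ := by gcongr
  obtain ⟨k₁, hk₁, hk₁'⟩ := exists_le_pow_le (X := K * m * Real.log p) (by linarith)
  obtain ⟨k₂, hk₂, hk₂'⟩ := exists_le_pow_le (X := K * Real.log p) (by linarith)
  obtain ⟨hp₁, hE₁, hA⟩ := hstep k₁ (hKm.trans hk₁)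
  obtain ⟨hp₂, hE₂, hB⟩ := hstep k₂ hk₂
  obtain ⟨a, b, ha, hb, hab⟩ := exists_orderOf_sq_mul_cube_eq (p := p) (by omega)
    (by norm_num) (by rintro k (rfl | rfl); exacts [hp₁, hp₂]) (hE₁ m (by linarith) hk₁)
    (by simpa using hE₂ 1 one_pos (by simpa using hk₂)) hA hB
  exact ⟨a, b, ha.trans (by gcongr), hb.trans (by gcongr), hab⟩

end LogWeights

/-- Corollary 2: assuming GRH mod `p`, there is a square-full primitive root mod `p` of size
at most `C * 2^(6 ω(p-1)) * ω(p-1) * (log p)^18 * log log p`. -/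
theorem least_squarefull_primitive_root_bound_GRH :
    ∃ C : ℝ, 0 < C ∧ ∀ (p : ℕ) [Fact p.Prime], 5 ≤ p →
      (∀ ψ : DirichletCharacter ℂ p, ∀ s : ℂ,
        DirichletCharacter.LFunction ψ s = 0 → 0 < s.re → s.re < 1 → s.re = 1/2) →
      ∃ g : ℕ, 1 ≤ g ∧ Squarefull g ∧ orderOf (g : ZMod p) = p - 1 ∧
        (g : ℝ) ≤ C * 2 ^ (6 * (p - 1).primeFactors.card) * ((p - 1).primeFactors.card : ℝ)
          * (Real.log p) ^ 18 * Real.log (Real.log p) := by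
  obtain ⟨p₀, K, hK, h⟩ := exists_squarefull_primitiveRoot_le_of_GRH
  refine ⟨3 * (2 ^ 15 * K ^ 15 + (p₀ : ℝ) ^ 5), by positivity, fun p _ hp5 hGRH => ?_⟩
  have hlog := three_halves_le_log hp5
  have hω : (1 : ℝ) ≤ (p - 1).primeFactors.card := by
    exact_mod_cast Finset.card_pos.mpr (Nat.nonempty_primeFactors.mpr (by omega))
  have hloglog : 1 / 3 ≤ Real.log (Real.log p) := by
    have h1 := Real.one_sub_inv_le_log_of_pos (show (0 : ℝ) < 3 / 2 by norm_num)
    have h2 := Real.log_le_log (by norm_num) hlog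
    norm_num at h1
    linarith
  have hbound : (2 ^ 15 * K ^ 15 + (p₀ : ℝ) ^ 5) * 2 ^ (6 * (p - 1).primeFactors.card) *
      Real.log p ^ 15 ≤ 3 * (2 ^ 15 * K ^ 15 + (p₀ : ℝ) ^ 5) *
        2 ^ (6 * (p - 1).primeFactors.card) * ((p - 1).primeFactors.card : ℝ) *
        Real.log p ^ 18 * Real.log (Real.log p) := by
    calc _ = 3 * (2 ^ 15 * K ^ 15 + (p₀ : ℝ) ^ 5) * 2 ^ (6 * (p - 1).primeFactors.card) * 1 *
          Real.log p ^ 15 * (1 / 3) := by ring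
      _ ≤ _ := by
        gcongr
        · linarith
        · norm_num
  rcases lt_or_ge p p₀ with hp | hp
  · obtain ⟨g, hg1, hgs, hgo, hgle⟩ := exists_squarefull_primitiveRoot_le_pow p
    refine ⟨g, hg1, hgs, hgo, le_trans ?_ hbound⟩
    have h1 : (g : ℝ) ≤ (p₀ : ℝ) ^ 5 := by
      exact_mod_cast hgle.trans (Nat.pow_le_pow_left hp.le 5)
    have h2 : (1 : ℝ) ≤ 2 ^ (6 * (p - 1).primeFactors.card) := one_le_pow₀ (by norm_num)
    have h3 : (1 : ℝ) ≤ Real.log p ^ 15 := one_le_pow₀ (by linarith)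
    calc (g : ℝ) ≤ (2 ^ 15 * K ^ 15 + (p₀ : ℝ) ^ 5) * 1 * 1 := by
          have : 0 ≤ 2 ^ 15 * K ^ 15 := by positivity
          linarith
      _ ≤ _ := by gcongr
  · obtain ⟨a, b, ha, hb, hab⟩ := h p hp5 hp hGRH
    refine ⟨a ^ 2 * b ^ 3, ?_, squarefull_sq_mul_cube a b, hab, le_trans ?_ hbound⟩
    · rw [Nat.one_le_iff_ne_zero]
      intro h0
      rw [h0, Nat.cast_zero, orderOf_zero] at hab
      omega
    · push_cast
      calc (a : ℝ) ^ 2 * (b : ℝ) ^ 3 ≤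
          ((2 * (K * 2 ^ (p - 1).primeFactors.card * Real.log p)) ^ 3) ^ 2 *
            ((2 * (K * Real.log p)) ^ 3) ^ 3 := by gcongr
        _ = 2 ^ 15 * K ^ 15 * 2 ^ (6 * (p - 1).primeFactors.card) * Real.log p ^ 15 := by
          rw [mul_comm 6, pow_mul]
          ring
        _ ≤ _ := by
          gcongr
          exact le_add_of_nonneg_right (by positivity)
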